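/- Let X be a reflexive real Banach space, let Q, ψ : X → ℝ and let r > 0. Assume that Q is even, that ψ is odd, and that for each λ ∈ [−r, r] the functional Q − λψ is sequentially weakly lower semicontinuous and coercive (i.e. (Q − λψ)(x) → +∞ as ‖x‖ → +∞). Finally, suppose that there is no global minimum point of Q at which ψ vanishes. Then sup_{|λ| ≤ r} inf_{x ∈ X} (Q(x) − λψ(x)) < inf_{x ∈ X} sup_{|λ| ≤ r} (Q(x) − λψ(x)). -/

import Mathlib

open Filter Topology

/-- A sequence converges weakly in a real normed space iff every continuous
linear functional converges along it. -/
def WeaklyConvergent {X : Type*} [NormedAddCommGroup X] [NormedSpace ℝ X]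
    (u : ℕ → X) (x : X) : Prop :=
  ∀ f : X →L[ℝ] ℝ, Tendsto (fun n => f (u n)) atTop (𝓝 (f x))

/-- A functional is sequentially weakly lower semicontinuous if
`Φ x ≤ liminf Φ (u n)` (in the extended real sense) whenever `u n ⇀ x`. -/
def SeqWeaklyLSC {X : Type*} [NormedAddCommGroup X] [NormedSpace ℝ X]
    (Φ : X → ℝ) : Prop :=
  ∀ (u : ℕ → X) (x : X), WeaklyConvergent u x →
    (Φ x : EReal) ≤ liminf (fun n => ((Φ (u n) : EReal))) atTop

/-- A functional is coercive if `Φ x → +∞` as `‖x‖ → +∞`. -/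
def Coercive {X : Type*} [NormedAddCommGroup X] (Φ : X → ℝ) : Prop :=
  ∀ M : ℝ, ∃ R : ℝ, ∀ x : X, R ≤ ‖x‖ → M ≤ Φ x

/-- A separable subspace of a real normed space admits a sequence of continuous functionals on the
whole space that separates its points. -/
theorem exists_seq_dual_eq_zero_of_separable {X : Type*} [NormedAddCommGroup X] [NormedSpace ℝ X]
    (Y : Submodule ℝ X) [TopologicalSpace.SeparableSpace Y] :
    ∃ g : ℕ → X →L[ℝ] ℝ, ∀ z ∈ Y, (∀ n, g n z = 0) → z = 0 := by
  choose g hg1 hg2 using fun n =>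
    exists_dual_vector'' ℝ ((TopologicalSpace.denseSeq Y n : Y) : X)
  refine ⟨g, fun z hz h0 => ?_⟩
  by_contra hne
  have hpos : 0 < ‖z‖ := norm_pos_iff.mpr hne
  obtain ⟨n, hn⟩ := (TopologicalSpace.denseRange_denseSeq Y).exists_dist_lt ⟨z, hz⟩
    (half_pos hpos)
  set d : X := ((TopologicalSpace.denseSeq Y n : Y) : X)
  have hdist : ‖z - d‖ < ‖z‖ / 2 := by
    rw [← dist_eq_norm]
    exact hn
  have hd : ‖d‖ ≤ ‖z - d‖ := by
    have h1 : g n (d - z) = ‖d‖ := by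
      rw [map_sub, h0 n, sub_zero]
      exact hg2 n
    calc ‖d‖ = g n (d - z) := h1.symm
      _ ≤ ‖g n (d - z)‖ := le_abs_self _
      _ ≤ 1 * ‖d - z‖ := (g n).le_of_opNorm_le (hg1 n) _
      _ = ‖z - d‖ := by rw [one_mul, norm_sub_rev]
  have htri : ‖z‖ ≤ ‖z - d‖ + ‖d‖ := by
    simpa using norm_add_le (z - d) d
  linarith

/-- In a reflexive space, norm-closed bounded convex sets are weakly compact. -/
theorem isCompact_toWeakSpace_image {X : Type*} [NormedAddCommGroup X] [NormedSpace ℝ X]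
    (hrefl : Function.Surjective (NormedSpace.inclusionInDoubleDual ℝ X)) {S : Set X}
    (hconv : Convex ℝ S) (hclosed : IsClosed S) (hbdd : Bornology.IsBounded S) :
    IsCompact (toWeakSpace ℝ X '' S) := by
  have hcl := hconv.toWeakSpace_closure (𝕜 := ℝ)
  rw [hclosed.closure_eq] at hcl
  rw [hcl]
  refine NormedSpace.isCompact_closure_of_isBounded ℝ X _ ?_ ?_
  · rwa [Set.preimage_image_eq _ (toWeakSpace ℝ X).injective]
  · intro φ _
    obtain ⟨x, hx⟩ := hrefl (WeakDual.toStrongDual φ)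
    exact ⟨toWeakSpace ℝ X x, hx⟩

/-- Bounded sequences in a reflexive space have weakly convergent subsequences. -/
theorem exists_weaklyConvergent_subseq {X : Type*} [NormedAddCommGroup X] [NormedSpace ℝ X]
    (hrefl : Function.Surjective (NormedSpace.inclusionInDoubleDual ℝ X))
    {u : ℕ → X} {R : ℝ} (hu : ∀ n, ‖u n‖ ≤ R) :
    ∃ (x : X) (k : ℕ → ℕ), StrictMono k ∧ WeaklyConvergent (u ∘ k) x := by
  let Y : Submodule ℝ X := (Submodule.span ℝ (Set.range u)).topologicalClosure
  have hsep : TopologicalSpace.IsSeparable (Y : Set X) := by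
    rw [Submodule.topologicalClosure_coe]
    exact ((Set.countable_range u).isSeparable.span (R := ℝ)).closure
  have : TopologicalSpace.SeparableSpace Y := hsep.separableSpace
  obtain ⟨g, hg⟩ := exists_seq_dual_eq_zero_of_separable Y
  let S : Set X := (Y : Set X) ∩ Metric.closedBall 0 R
  have hK : IsCompact (toWeakSpace ℝ X '' S) :=
    isCompact_toWeakSpace_image hrefl (Y.convex.inter (convex_closedBall 0 R))
      ((Submodule.isClosed_topologicalClosure _).inter Metric.isClosed_closedBall)
      (Metric.isBounded_closedBall.subset Set.inter_subset_right)
  have heval (f : X →L[ℝ] ℝ) :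
      Continuous fun w : WeakSpace ℝ X => f ((toWeakSpace ℝ X).symm w) :=
    WeakBilin.eval_continuous (topDualPairing ℝ X).flip f
  let K : Set (WeakSpace ℝ X) := toWeakSpace ℝ X '' S
  have : CompactSpace K := isCompact_iff_compactSpace.mp hK
  have : TopologicalSpace.MetrizableSpace K := by
    refine Metric.PiNatEmbed.TopologicalSpace.MetrizableSpace.of_countable_separating
      (fun n (w : K) => g n ((toWeakSpace ℝ X).symm w.1))
      (fun n => (heval (g n)).comp continuous_subtype_val) ?_
    rintro ⟨_, x, hx, rfl⟩ ⟨_, y, hy, rfl⟩ hxy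
    by_contra! h
    refine hxy (Subtype.ext (congrArg (toWeakSpace ℝ X)
      (sub_eq_zero.mp (hg (x - y) (Y.sub_mem hx.1 hy.1) ?_))))
    intro n
    rw [map_sub, sub_eq_zero]
    simpa using h n
  have huS (n : ℕ) : u n ∈ S :=
    ⟨Submodule.le_topologicalClosure _ (Submodule.subset_span ⟨n, rfl⟩), by simpa using hu n⟩
  obtain ⟨a, k, hk, hlim⟩ := CompactSpace.tendsto_subseq
    (fun n => (⟨toWeakSpace ℝ X (u n), u n, huS n, rfl⟩ : K))
  refine ⟨(toWeakSpace ℝ X).symm a.1, k, hk, fun f => ?_⟩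
  have := ((heval f).comp continuous_subtype_val).tendsto a |>.comp hlim
  simpa [Function.comp_def] using this

/-- The direct method: a coercive sequentially weakly lower semicontinuous functional on a
reflexive space attains its infimum. -/
theorem SeqWeaklyLSC.exists_forall_le {X : Type*} [NormedAddCommGroup X] [NormedSpace ℝ X]
    (hrefl : Function.Surjective (NormedSpace.inclusionInDoubleDual ℝ X))
    {Φ : X → ℝ} (hΦ : SeqWeaklyLSC Φ) (hcoer : Coercive Φ) : ∃ x, ∀ y, Φ x ≤ Φ y := by
  obtain ⟨R, hR⟩ := hcoer (Φ 0)
  let S : Set EReal := (fun x => (Φ x : EReal)) '' Metric.closedBall 0 (max R 0)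
  have h0 : (0 : X) ∈ Metric.closedBall (0 : X) (max R 0) := by simp
  obtain ⟨v, -, hv, hvS⟩ := exists_seq_tendsto_sInf (S := S) ⟨_, 0, h0, rfl⟩ (OrderBot.bddBelow S)
  choose u hu huv using hvS
  obtain ⟨x, k, hk, hx⟩ := exists_weaklyConvergent_subseq hrefl
    (u := u) (R := max R 0) (fun n => by simpa using hu n)
  have hle : (Φ x : EReal) ≤ sInf S := by
    refine (hΦ _ _ hx).trans_eq (Tendsto.liminf_eq ?_)
    have hlim := hv.comp hk.tendsto_atTop
    rw [← funext huv] at hlim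
    exact hlim
  have hball (y : X) (hy : y ∈ Metric.closedBall (0 : X) (max R 0)) : Φ x ≤ Φ y :=
    EReal.coe_le_coe_iff.mp (hle.trans (sInf_le ⟨y, hy, rfl⟩))
  refine ⟨x, fun y => ?_⟩
  by_cases hy : ‖y‖ ≤ max R 0
  · exact hball y (by simpa using hy)
  · exact (hball 0 h0).trans (hR y ((le_max_left _ _).trans (not_le.mp hy).le))

/-- The pointwise maximum of two sequentially weakly lower semicontinuous functionals is again
sequentially weakly lower semicontinuous. -/
theorem SeqWeaklyLSC.max {X : Type*} [NormedAddCommGroup X] [NormedSpace ℝ X] {Φ Ψ : X → ℝ}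
    (hΦ : SeqWeaklyLSC Φ) (hΨ : SeqWeaklyLSC Ψ) : SeqWeaklyLSC fun x => max (Φ x) (Ψ x) := by
  intro u x hu
  rcases max_choice (Φ x) (Ψ x) with h | h
  · simp only [h]
    exact (hΦ u x hu).trans
      (liminf_le_liminf (.of_forall fun n => EReal.coe_le_coe_iff.mpr (le_max_left _ _)))
  · simp only [h]
    exact (hΨ u x hu).trans
      (liminf_le_liminf (.of_forall fun n => EReal.coe_le_coe_iff.mpr (le_max_right _ _)))

/-- A functional bounded below by a coercive one is coercive. -/
theorem Coercive.mono {X : Type*} [NormedAddCommGroup X] {Φ Ψ : X → ℝ}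
    (hΦ : Coercive Φ) (h : ∀ x, Φ x ≤ Ψ x) : Coercive Ψ := by
  intro M
  obtain ⟨R, hR⟩ := hΦ M
  exact ⟨R, fun x hx => (hR x hx).trans (h x)⟩

/-- **Ricceri's strict minimax inequality for even/odd pairs** ([5], Theorem 2.2).
Let `X` be a reflexive real Banach space, `Q ψ : X → ℝ`, `r > 0`.  Assume `Q` is
even, `ψ` is odd, and for each `λ ∈ [-r, r]` the functional `Q - λψ` is
sequentially weakly lower semicontinuous and coercive.  If there is no global
minimum of `Q` at which `ψ` vanishes, then
`sup_{|λ| ≤ r} inf_X (Q - λψ) < inf_X sup_{|λ| ≤ r} (Q - λψ)`. -/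
theorem ricceri_even_odd_minimax
    {X : Type*} [NormedAddCommGroup X] [NormedSpace ℝ X] [CompleteSpace X]
    (hrefl : Function.Surjective (NormedSpace.inclusionInDoubleDual ℝ X))
    (Q ψ : X → ℝ) (r : ℝ) (hr : 0 < r)
    (hQeven : ∀ x : X, Q (-x) = Q x)
    (hψodd : ∀ x : X, ψ (-x) = -ψ x)
    (hlsc : ∀ lam ∈ Set.Icc (-r) r, SeqWeaklyLSC (fun x => Q x - lam * ψ x))
    (hcoer : ∀ lam ∈ Set.Icc (-r) r, Coercive (fun x => Q x - lam * ψ x))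
    (hmin : ¬ ∃ x₀ : X, (∀ x : X, Q x₀ ≤ Q x) ∧ ψ x₀ = 0) :
    (⨆ lam ∈ Set.Icc (-r) r, ⨅ x : X, ((Q x - lam * ψ x : ℝ) : EReal)) <
      ⨅ x : X, ⨆ lam ∈ Set.Icc (-r) r, ((Q x - lam * ψ x : ℝ) : EReal) := by
  have hrmem : r ∈ Set.Icc (-r) r := ⟨by linarith, le_rfl⟩
  have hnmem : -r ∈ Set.Icc (-r) r := ⟨le_rfl, by linarith⟩
  obtain ⟨x₁, hx₁⟩ := ((hlsc r hrmem).max (hlsc (-r) hnmem)).exists_forall_le hrefl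
    ((hcoer r hrmem).mono fun x => le_max_left _ _)
  set m : ℝ := max (Q x₁ - r * ψ x₁) (Q x₁ - -r * ψ x₁)
  by_contra hlt
  have hmQ (x : X) : m ≤ Q x := by
    rw [← EReal.coe_le_coe_iff]
    calc (m : EReal)
        ≤ ⨅ x : X, ⨆ lam ∈ Set.Icc (-r) r, ((Q x - lam * ψ x : ℝ) : EReal) := by
          refine le_iInf fun y => (EReal.coe_le_coe_iff.mpr (hx₁ y)).trans ?_
          rw [EReal.coe_strictMono.monotone.map_max]
          exact max_le
            (le_iSup₂ (f := fun lam (_ : lam ∈ Set.Icc (-r) r) =>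
              ((Q y - lam * ψ y : ℝ) : EReal)) r hrmem)
            (le_iSup₂ (f := fun lam (_ : lam ∈ Set.Icc (-r) r) =>
              ((Q y - lam * ψ y : ℝ) : EReal)) (-r) hnmem)
      _ ≤ ⨆ lam ∈ Set.Icc (-r) r, ⨅ x : X, ((Q x - lam * ψ x : ℝ) : EReal) := not_lt.mp hlt
      _ ≤ Q x := by
          refine iSup₂_le fun lam _ => ?_
          rcases le_total 0 (lam * ψ x) with h | h
          · exact (iInf_le _ x).trans (EReal.coe_le_coe_iff.mpr (by linarith))
          · refine (iInf_le _ (-x)).trans (EReal.coe_le_coe_iff.mpr ?_)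
            rw [hQeven, hψodd]
            linarith
  have h1 : Q x₁ - r * ψ x₁ ≤ m := le_max_left _ _
  have h2 : Q x₁ - -r * ψ x₁ ≤ m := le_max_right _ _
  have h3 := hmQ x₁
  have hψ : ψ x₁ = 0 := by
    have : r * ψ x₁ = 0 := by linarith
    exact (mul_eq_zero.mp this).resolve_left hr.ne'
  refine hmin ⟨x₁, fun x => ?_, hψ⟩
  rw [hψ, mul_zero, sub_zero] at h1
  exact h1.trans (hmQ x)
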